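/- Almost sure convergence of the normalized cross-information functional (Lemma 3(vii) of the paper): under the stated assumptions, P-almost surely (1/T)∫₀^T φ₀(s) φ₁(s) R̄(s, X_s) ds → Φ₀₁·κ̄ as T → ∞. -/

import Mathlib

open Filter MeasureTheory

/-- The time averages of a function integrable on the half-line tend to zero. -/
theorem tendsto_average_zero_of_integrableOn_Ioi {f : ℝ → ℝ}
    (hf : IntegrableOn f (Set.Ioi 0)) :
    Tendsto (fun T : ℝ => (1 / T) * ∫ s in (0:ℝ)..T, f s) atTop (nhds 0) := by
  have h := intervalIntegral_tendsto_integral_Ioi 0 hf tendsto_id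
  simpa using tendsto_inv_atTop_zero.mul h

/-- A jointly measurable process whose expected absolute value is dominated by an integrable
function of time has almost surely integrable paths. -/
theorem ae_integrableOn_Ioi_of_integral_abs_le {Ω : Type*} [MeasurableSpace Ω] {P : Measure Ω}
    [SFinite P] {g : ℝ → Ω → ℝ} (hg : Measurable (Function.uncurry g)) {h : ℝ → ℝ}
    (hh : IntegrableOn h (Set.Ioi 0)) (hint : ∀ s, 0 < s → Integrable (g s) P)
    (hle : ∀ s, 0 < s → ∫ ω, |g s ω| ∂P ≤ h s) :
    ∀ᵐ ω ∂P, IntegrableOn (fun s => g s ω) (Set.Ioi 0) := by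
  have hprod : Integrable (Function.uncurry g) ((volume.restrict (Set.Ioi 0)).prod P) := by
    rw [integrable_prod_iff hg.aestronglyMeasurable]
    refine ⟨(ae_restrict_mem measurableSet_Ioi).mono fun s hs => hint s hs, ?_⟩
    refine Integrable.mono' hh hg.aestronglyMeasurable.norm.integral_prod_right' ?_
    filter_upwards [ae_restrict_mem measurableSet_Ioi] with s hs
    rw [Real.norm_of_nonneg (integral_nonneg fun _ => norm_nonneg _)]
    exact hle s hs
  exact hprod.prod_left_ae

/-- The ratio of a multiple of `exp (s ^ 3)` to `exp (s ^ 5)` decays exponentially. -/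
theorem one_add_mul_exp_div_le {C d s : ℝ} (hC : 0 ≤ C) (hd : 0 ≤ d) (hs : 0 ≤ s) :
    (1 + C * Real.exp (s ^ 3)) / (d + Real.exp (s ^ 5)) ≤
      (1 + C) * Real.exp 2 * Real.exp (-s) := by
  have hpoly : s ^ 3 ≤ 2 + -s + s ^ 5 := by
    rcases le_total s 1 with h | h
    · nlinarith [pow_le_one₀ hs h (n := 3), pow_nonneg hs 5]
    · have h5 : s ^ 5 - s ^ 3 = s ^ 3 * (s ^ 2 - 1) := by ring
      have h3 : 1 ≤ s ^ 3 := one_le_pow₀ h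
      nlinarith [mul_le_mul_of_nonneg_right h3 (show 0 ≤ s ^ 2 - 1 by nlinarith)]
  have hexp : Real.exp (s ^ 3) ≤ Real.exp 2 * Real.exp (-s) * Real.exp (s ^ 5) := by
    rw [← Real.exp_add, ← Real.exp_add]
    exact Real.exp_le_exp.2 hpoly
  have hone : 1 ≤ Real.exp (s ^ 3) := Real.one_le_exp (by positivity)
  rw [div_le_iff₀ (by positivity)]
  calc 1 + C * Real.exp (s ^ 3) ≤ (1 + C) * Real.exp (s ^ 3) := by linarith
    _ ≤ (1 + C) * (Real.exp 2 * Real.exp (-s) * Real.exp (s ^ 5)) := by gcongr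
    _ = (1 + C) * Real.exp 2 * Real.exp (-s) * Real.exp (s ^ 5) := by ring
    _ ≤ (1 + C) * Real.exp 2 * Real.exp (-s) * (d + Real.exp (s ^ 5)) := by
      gcongr
      linarith

/-- Lemma 3(vii) of the paper: almost sure convergence of the normalized
cross-information functional: P-a.s., (1/T)∫₀^T φ₀(s)φ₁(s) R̄(s, X_s) ds → Φ₀₁·κ̄ as T → ∞. -/
theorem normalized_cross_information_converges_almost_surely
    {Ω : Type*} [MeasurableSpace Ω] (P : Measure Ω) [IsProbabilityMeasure P]
    (X : ℝ → Ω → ℝ) (hX : Measurable (Function.uncurry X))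
    (C : ℝ) (hC : 0 < C)
    (hXint : ∀ s : ℝ, 0 ≤ s → Integrable (fun ω => (X s ω) ^ 2) P)
    (hX2 : ∀ s : ℝ, 0 ≤ s → (∫ ω, (X s ω) ^ 2 ∂P) ≤ C * Real.exp (s ^ 3))
    (Rbar : ℝ → ℝ → ℝ) (hRbar : Measurable (Function.uncurry Rbar))
    (κbar : ℝ) (M d : ℝ) (hM : 0 < M) (hd : 0 < d)
    (hband : ∀ s : ℝ, 0 ≤ s → ∀ x : ℝ,
      |Rbar s x - κbar| ≤ M * (1 + x ^ 2) / (d + Real.exp (s ^ 5)))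
    (φ₀ φ₁ : ℝ → ℝ) (hφ₀c : Continuous φ₀) (hφ₁c : Continuous φ₁)
    (hφ₀b : ∃ B : ℝ, ∀ t : ℝ, |φ₀ t| ≤ B) (hφ₁b : ∃ B : ℝ, ∀ t : ℝ, |φ₁ t| ≤ B)
    (Φ01 : ℝ)
    (hΦ01 : Tendsto (fun T : ℝ => (1 / T) * ∫ s in (0:ℝ)..T, φ₀ s * φ₁ s)
      atTop (nhds Φ01)) :
    ∀ᵐ ω ∂P, Tendsto (fun T : ℝ =>
        (1 / T) * ∫ s in (0:ℝ)..T, φ₀ s * φ₁ s * Rbar s (X s ω))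
      atTop (nhds (Φ01 * κbar)) := by
  obtain ⟨B₀, hB₀⟩ := hφ₀b
  obtain ⟨B₁, hB₁⟩ := hφ₁b
  have hB₀0 : 0 ≤ B₀ := (abs_nonneg _).trans (hB₀ 0)
  have hB₁0 : 0 ≤ B₁ := (abs_nonneg _).trans (hB₁ 0)
  set g : ℝ → Ω → ℝ := fun s ω => φ₀ s * φ₁ s * (Rbar s (X s ω) - κbar) with hg_def
  have hg : Measurable (Function.uncurry g) := by
    have hR : Measurable fun p : ℝ × Ω => Rbar p.1 (X p.1 p.2) :=
      hRbar.comp (measurable_fst.prodMk hX)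
    exact ((hφ₀c.measurable.comp measurable_fst).mul
      (hφ₁c.measurable.comp measurable_fst)).mul (hR.sub_const κbar)
  have hbound : ∀ s, 0 < s → ∀ ω,
      |g s ω| ≤ B₀ * B₁ * (M * (1 + X s ω ^ 2) / (d + Real.exp (s ^ 5))) := fun s hs ω => by
    rw [hg_def, abs_mul, abs_mul]
    exact mul_le_mul (mul_le_mul (hB₀ s) (hB₁ s) (abs_nonneg _) hB₀0) (hband s hs.le _)
      (abs_nonneg _) (by positivity)
  have hdom : ∀ s, 0 < s → Integrable
      (fun ω => B₀ * B₁ * (M * (1 + X s ω ^ 2) / (d + Real.exp (s ^ 5)))) P := fun s hs =>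
    ((((integrable_const 1).add (hXint s hs.le)).const_mul M).div_const _).const_mul _
  have hgint : ∀ s, 0 < s → Integrable (g s) P := fun s hs =>
    (hdom s hs).mono' (hg.comp measurable_prodMk_left).aestronglyMeasurable
      (ae_of_all _ (hbound s hs))
  have hgle : ∀ s, 0 < s → ∫ ω, |g s ω| ∂P ≤
      B₀ * B₁ * M * ((1 + C) * Real.exp 2) * Real.exp (-s) := fun s hs => by
    calc ∫ ω, |g s ω| ∂P
        ≤ ∫ ω, B₀ * B₁ * (M * (1 + X s ω ^ 2) / (d + Real.exp (s ^ 5))) ∂P :=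
          integral_mono (hgint s hs).abs (hdom s hs) (hbound s hs)
      _ = B₀ * B₁ * (M * (1 + ∫ ω, X s ω ^ 2 ∂P) / (d + Real.exp (s ^ 5))) := by
          rw [integral_const_mul, integral_div, integral_const_mul,
            integral_add (integrable_const 1) (hXint s hs.le)]
          simp
      _ ≤ B₀ * B₁ * (M * (1 + C * Real.exp (s ^ 3)) / (d + Real.exp (s ^ 5))) := by
          gcongr
          exact hX2 s hs.le
      _ = B₀ * B₁ * M * ((1 + C * Real.exp (s ^ 3)) / (d + Real.exp (s ^ 5))) := by ring
      _ ≤ B₀ * B₁ * M * ((1 + C) * Real.exp 2 * Real.exp (-s)) := by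
          gcongr
          exact one_add_mul_exp_div_le hC.le hd.le hs.le
      _ = _ := by ring
  filter_upwards [ae_integrableOn_Ioi_of_integral_abs_le hg
    ((integrableOn_exp_neg_Ioi 0).const_mul _) hgint hgle] with ω hω
  have hlim := (tendsto_average_zero_of_integrableOn_Ioi hω).add (hΦ01.mul_const κbar)
  rw [zero_add] at hlim
  refine hlim.congr' ?_
  filter_upwards [eventually_ge_atTop 0] with T hT
  have hgT : IntervalIntegrable (fun s => g s ω) volume 0 T :=
    (intervalIntegrable_iff_integrableOn_Ioc_of_le hT).2 (hω.mono_set Set.Ioc_subset_Ioi_self)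
  have hφT : IntervalIntegrable (fun s => φ₀ s * φ₁ s * κbar) volume 0 T :=
    ((hφ₀c.mul hφ₁c).mul_const κbar).intervalIntegrable 0 T
  rw [mul_assoc, ← intervalIntegral.integral_mul_const, ← mul_add,
    ← intervalIntegral.integral_add hgT hφT]
  congr 2
  ext s
  simp only [hg_def]
  ring
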